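/- For every integer r ≥ 3 there exists n₀ ∈ ℕ such that for all n ≥ n₀ the following holds. Let δ = 1/(34·log₂ n), let ξ be a real number with 0 < ξ < (log₂ r − 1)·n^{−1/3}·log₂ n + δ, and let A ⊆ [n] with |A| = (1 − ξ)n. If P is a good r-template of A with g(P, A) > 2^{(1−δ)n}, then there exist two colors i, j ∈ [r] with i ≠ j such that the number of integers x ∈ A with P(x) = {i, j} is at least (1 − 2δ)n. -/

import Mathlib

/-- A coloring `c : A → Fin r` is rainbow 3-AP-free if no 3-AP of `A`
receives three pairwise distinct colors. -/
def RainbowAPFree {r : ℕ} (A : Finset ℕ) (c : A → Fin r) : Prop :=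
  ∀ a d : ℕ, 0 < d → ∀ (h1 : a ∈ A) (h2 : a + d ∈ A) (h3 : a + 2 * d ∈ A),
    c ⟨a, h1⟩ = c ⟨a + d, h2⟩ ∨ c ⟨a + d, h2⟩ = c ⟨a + 2 * d, h3⟩ ∨
      c ⟨a, h1⟩ = c ⟨a + 2 * d, h3⟩

/-- `fAP n` is the number of 3-APs in `[n] = {1, …, n}`. -/
def fAP (n : ℕ) : ℕ :=
  (((Finset.Icc 1 n) ×ˢ (Finset.Icc 1 n)).filter
    fun p => p.1 + p.2 ∈ Finset.Icc 1 n ∧ p.1 + 2 * p.2 ∈ Finset.Icc 1 n).card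

/-- `Rtemp n P` is the number of pairs consisting of a 3-AP `(a, a+d, a+2d)` of
`[n]` together with pairwise distinct colors `i ∈ P a`, `j ∈ P (a+d)`,
`ℓ ∈ P (a+2d)`. -/
def Rtemp {r : ℕ} (n : ℕ) (P : ℕ → Finset (Fin r)) : ℕ :=
  ((((Finset.Icc 1 n) ×ˢ (Finset.Icc 1 n)) ×ˢ
      ((Finset.univ : Finset (Fin r)) ×ˢ Finset.univ ×ˢ Finset.univ)).filter
    fun t => t.1.1 + 2 * t.1.2 ≤ n ∧ t.2.1 ∈ P t.1.1 ∧
      t.2.2.1 ∈ P (t.1.1 + t.1.2) ∧ t.2.2.2 ∈ P (t.1.1 + 2 * t.1.2) ∧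
      t.2.1 ≠ t.2.2.1 ∧ t.2.2.1 ≠ t.2.2.2 ∧ t.2.1 ≠ t.2.2.2).card

/-- `P` is a good `r`-template of `A` (inside `[n]`) if every `x ∈ A` has a
nonempty palette and `R(P) ≤ n^{-1/3} · f(n)`. -/
def GoodTemplate {r : ℕ} (n : ℕ) (A : Finset ℕ) (P : ℕ → Finset (Fin r)) : Prop :=
  (∀ x ∈ A, (P x).Nonempty) ∧
    (Rtemp n P : ℝ) ≤ (n : ℝ) ^ (-(1/3 : ℝ)) * fAP n

/-- `gPA A P` is the number of rainbow 3-AP-free `r`-colorings of `A` that are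
subtemplates of `P`, i.e. with `c x ∈ P x` for every `x ∈ A`. -/
noncomputable def gPA {r : ℕ} (A : Finset ℕ) (P : ℕ → Finset (Fin r)) : ℕ :=
  Nat.card {c : A → Fin r // RainbowAPFree A c ∧
    ∀ (x : ℕ) (hx : x ∈ A), c ⟨x, hx⟩ ∈ P x}

/-- A triple of palettes admits a rainbow choice. -/
def BadT {r : ℕ} (X Y Z : Finset (Fin r)) : Prop :=
  ∃ i ∈ X, ∃ j ∈ Y, ∃ k ∈ Z, i ≠ j ∧ j ≠ k ∧ i ≠ k

open Classical in
/-- The set of 3-APs `(a,d)` with a rainbow choice. -/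
noncomputable def badSet {r : ℕ} (n : ℕ) (P : ℕ → Finset (Fin r)) : Finset (ℕ × ℕ) :=
  ((Finset.Icc 1 n) ×ˢ (Finset.Icc 1 n)).filter
    fun p => p.1 + 2 * p.2 ≤ n ∧ BadT (P p.1) (P (p.1 + p.2)) (P (p.1 + 2 * p.2))

lemma mem_badSet {r : ℕ} {n : ℕ} {P : ℕ → Finset (Fin r)} {a d : ℕ} :
    (a, d) ∈ badSet n P ↔ 1 ≤ a ∧ 1 ≤ d ∧ a + 2 * d ≤ n ∧
      BadT (P a) (P (a + d)) (P (a + 2 * d)) := by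
  unfold badSet
  simp only [Finset.mem_filter, Finset.mem_product, Finset.mem_Icc]
  constructor
  · rintro ⟨⟨⟨h1, h2⟩, h3, h4⟩, h5, h6⟩
    exact ⟨h1, h3, h5, h6⟩
  · rintro ⟨h1, h3, h5, h6⟩
    exact ⟨⟨⟨h1, by omega⟩, h3, by omega⟩, h5, h6⟩

lemma badSet_card_le {r : ℕ} (n : ℕ) (P : ℕ → Finset (Fin r)) :
    (badSet n P).card ≤ Rtemp n P := by
  classical
  unfold Rtemp
  refine le_trans (Finset.card_le_card ?_) (Finset.card_image_le (f := Prod.fst))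
  rintro ⟨a, d⟩ h
  obtain ⟨h1, h2, h3, i, hi, j, hj, k, hk, hij, hjk, hik⟩ := mem_badSet.1 h
  refine Finset.mem_image.2 ⟨((a, d), (i, j, k)), ?_, rfl⟩
  simp only [Finset.mem_filter, Finset.mem_product, Finset.mem_Icc, Finset.mem_univ, and_true,
    true_and]
  exact ⟨⟨⟨h1, by omega⟩, h2, by omega⟩, h3, hi, hj, hk, hij, hjk, hik⟩

lemma fAP_le (n : ℕ) : fAP n ≤ n * n := by
  unfold fAP
  refine (Finset.card_filter_le _ _).trans ?_
  simp

lemma badT_ends {r : ℕ} {X Y Z : Finset (Fin r)} (hX : 2 ≤ X.card) (hZ : 2 ≤ Z.card)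
    (hY : Y.Nonempty) (h : ¬ (X = Z ∧ X.card = 2)) : BadT X Y Z := by
  obtain ⟨l, hl⟩ := hY
  by_contra hb
  have key : ∀ i ∈ X, ∀ k ∈ Z, i ≠ l → k ≠ l → i = k := by
    intro i hi k hk h1 h2
    by_contra h3
    exact hb ⟨i, hi, l, hl, k, hk, h1, fun e => h2 e.symm, h3⟩
  obtain ⟨i, hi, hil⟩ := Finset.exists_mem_ne (show 1 < X.card by omega) l
  obtain ⟨k, hk, hkl⟩ := Finset.exists_mem_ne (show 1 < Z.card by omega) l
  have hik := key i hi k hk hil hkl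
  have hc : ({l, i} : Finset (Fin r)).card = 2 := Finset.card_pair (Ne.symm hil)
  have hX' : X = {l, i} := by
    apply Finset.eq_of_subset_of_card_le
    · intro t ht
      by_cases htl : t = l
      · simp [htl]
      · have := key t ht k hk htl hkl
        simp [this, hik]
    · omega
  have hZ' : Z = {l, i} := by
    apply Finset.eq_of_subset_of_card_le
    · intro t ht
      by_cases htl : t = l
      · simp [htl]
      · have := key i hi t ht hil htl
        simp [this]
    · omega
  exact h ⟨hX'.trans hZ'.symm, by rw [hX', hc]⟩

lemma BadT.swap23 {r : ℕ} {X Y Z : Finset (Fin r)} (h : BadT X Y Z) : BadT X Z Y := by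
  obtain ⟨i, hi, j, hj, k, hk, h1, h2, h3⟩ := h
  exact ⟨i, hi, k, hk, j, hj, h3, h2.symm, h1⟩

lemma BadT.rev {r : ℕ} {X Y Z : Finset (Fin r)} (h : BadT X Y Z) : BadT Z Y X := by
  obtain ⟨i, hi, j, hj, k, hk, h1, h2, h3⟩ := h
  exact ⟨k, hk, j, hj, i, hi, h2.symm, h1.symm, h3.symm⟩

lemma lemC {r : ℕ} (n : ℕ) (P : ℕ → Finset (Fin r)) (W : Finset ℕ) (D : Finset (ℕ × ℕ))
    (hD : ∀ a d, (a, d) ∈ D → 1 ≤ a ∧ 1 ≤ d ∧ a + 2 * d ≤ n)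
    (hb : ∀ a d, (a, d) ∈ D → a ∈ W → a + d ∈ W → a + 2 * d ∈ W →
      BadT (P a) (P (a + d)) (P (a + 2 * d))) :
    D.card ≤ (badSet n P).card + 3 * ((Finset.Icc 1 n \ W).card * n) := by
  classical
  set U := Finset.Icc 1 n \ W with hU
  have hUm : ∀ m, 1 ≤ m → m ≤ n → m ∉ W → m ∈ U := by
    intro m h1 h2 h3; simp [hU, h1, h2, h3]
  have hsub : D ⊆ ((badSet n P ∪ (U ×ˢ Finset.Icc 1 n)) ∪
      (U ×ˢ Finset.Icc 1 n).image (fun p => (p.1 - p.2, p.2))) ∪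
      (U ×ˢ Finset.Icc 1 n).image (fun p => (p.1 - 2 * p.2, p.2)) := by
    rintro ⟨a, d⟩ h
    obtain ⟨h1, h2, h3⟩ := hD a d h
    simp only [Finset.mem_union]
    by_cases ha : a ∈ W
    · by_cases hb1 : a + d ∈ W
      · by_cases hc : a + 2 * d ∈ W
        · exact Or.inl (Or.inl (Or.inl (mem_badSet.2 ⟨h1, h2, h3, hb a d h ha hb1 hc⟩)))
        · refine Or.inr (Finset.mem_image.2 ⟨(a + 2 * d, d), ?_, ?_⟩)
          · exact Finset.mem_product.2 ⟨hUm _ (by omega) (by omega) hc,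
              Finset.mem_Icc.2 ⟨h2, by simp only; omega⟩⟩
          · simp
      · refine Or.inl (Or.inr (Finset.mem_image.2 ⟨(a + d, d), ?_, ?_⟩))
        · exact Finset.mem_product.2 ⟨hUm _ (by omega) (by omega) hb1,
              Finset.mem_Icc.2 ⟨h2, by simp only; omega⟩⟩
        · simp
    · exact Or.inl (Or.inl (Or.inr (Finset.mem_product.2 ⟨hUm _ (by omega) (by omega) ha,
              Finset.mem_Icc.2 ⟨h2, by simp only; omega⟩⟩)))
  have hcU : (U ×ˢ Finset.Icc 1 n).card = U.card * n := by simp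
  have h1 := Finset.card_le_card hsub
  have i1 := Finset.card_image_le (s := U ×ˢ Finset.Icc 1 n) (f := fun p => (p.1 - p.2, p.2))
  have i2 := Finset.card_image_le (s := U ×ˢ Finset.Icc 1 n)
    (f := fun p => (p.1 - 2 * p.2, p.2))
  have u1 := h1.trans (Finset.card_union_le _ _)
  have u2 := Finset.card_union_le (badSet n P ∪ (U ×ˢ Finset.Icc 1 n))
    ((U ×ˢ Finset.Icc 1 n).image (fun p => (p.1 - p.2, p.2)))
  have u3 := Finset.card_union_le (badSet n P) (U ×ˢ Finset.Icc 1 n)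
  rw [hcU] at i1 i2 u3
  omega

lemma lemB {r : ℕ} (n : ℕ) (P : ℕ → Finset (Fin r)) (S W : Finset ℕ)
    (hS : ∀ s ∈ S, 1 ≤ s ∧ s ≤ n)
    (hb : ∀ s ∈ S, ∀ y ∈ W, ∀ z ∈ W, BadT (P s) (P y) (P z)) :
    S.card * (n / 4) ≤ 2 * (badSet n P).card + 2 * (S.card * (Finset.Icc 1 n \ W).card) := by
  classical
  set U := Finset.Icc 1 n \ W with hU
  have hUm : ∀ m, 1 ≤ m → m ≤ n → m ∉ W → m ∈ U := by
    intro m h1 h2 h3; simp [hU, h1, h2, h3]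
  set L := S.filter (fun s => 2 * s ≤ n) with hL
  set H := S.filter (fun s => ¬ 2 * s ≤ n) with hH
  have hLH : L.card + H.card = S.card := Finset.card_filter_add_card_filter_not _
  have low : L.card * (n / 4) ≤ (badSet n P).card + 2 * (L.card * U.card) := by
    have hsub : L ×ˢ Finset.Icc 1 (n / 4) ⊆ (badSet n P ∪
        (L ×ˢ U).image (fun p => (p.1, p.2 - p.1))) ∪
        (L ×ˢ U).image (fun p => (p.1, (p.2 - p.1) / 2)) := by
      rintro ⟨s, d⟩ h
      simp only [Finset.mem_product, Finset.mem_Icc] at h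
      obtain ⟨hs, h1, h2⟩ := h
      have hs' := Finset.mem_filter.1 hs
      have := hS s hs'.1
      simp only [Finset.mem_union]
      by_cases hy : s + d ∈ W
      · by_cases hz : s + 2 * d ∈ W
        · exact Or.inl (Or.inl (mem_badSet.2 ⟨by omega, h1, by omega, hb s hs'.1 _ hy _ hz⟩))
        · refine Or.inr (Finset.mem_image.2 ⟨(s, s + 2 * d), ?_, ?_⟩)
          · exact Finset.mem_product.2 ⟨hs, hUm _ (by omega) (by omega) hz⟩
          · simp
      · refine Or.inl (Or.inr (Finset.mem_image.2 ⟨(s, s + d), ?_, ?_⟩))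
        · exact Finset.mem_product.2 ⟨hs, hUm _ (by omega) (by omega) hy⟩
        · simp
    have h1 := Finset.card_le_card hsub
    have i1 := Finset.card_image_le (s := L ×ˢ U) (f := fun p => (p.1, p.2 - p.1))
    have i2 := Finset.card_image_le (s := L ×ˢ U) (f := fun p => (p.1, (p.2 - p.1) / 2))
    have u1 := h1.trans (Finset.card_union_le _ _)
    have u2 := Finset.card_union_le (badSet n P) ((L ×ˢ U).image (fun p => (p.1, p.2 - p.1)))
    simp only [Finset.card_product, Nat.card_Icc, Nat.add_sub_cancel] at i1 i2 u1
    omega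
  have high : H.card * (n / 4) ≤ (badSet n P).card + 2 * (H.card * U.card) := by
    have hsub : H ×ˢ Finset.Icc 1 (n / 4) ⊆
        ((badSet n P).image (fun p => (p.1 + 2 * p.2, p.2)) ∪
        (H ×ˢ U).image (fun p => (p.1, p.1 - p.2))) ∪
        (H ×ˢ U).image (fun p => (p.1, (p.1 - p.2) / 2)) := by
      rintro ⟨s, d⟩ h
      simp only [Finset.mem_product, Finset.mem_Icc] at h
      obtain ⟨hs, h1, h2⟩ := h
      have hs' := Finset.mem_filter.1 hs
      have := hS s hs'.1
      have hs2 := hs'.2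
      obtain ⟨a, rfl⟩ : ∃ a, s = a + 2 * d := ⟨s - 2 * d, by omega⟩
      simp only [Finset.mem_union]
      by_cases hy : a + d ∈ W
      · by_cases hz : a ∈ W
        · exact Or.inl (Or.inl (Finset.mem_image.2 ⟨(a, d), mem_badSet.2 ⟨by omega, h1, by omega,
            (hb _ hs'.1 _ hy _ hz).rev⟩, rfl⟩))
        · refine Or.inr (Finset.mem_image.2 ⟨(a + 2 * d, a), ?_, ?_⟩)
          · exact Finset.mem_product.2 ⟨hs, hUm _ (by omega) (by omega) hz⟩
          · simp
      · refine Or.inl (Or.inr (Finset.mem_image.2 ⟨(a + 2 * d, a + d), ?_, ?_⟩))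
        · exact Finset.mem_product.2 ⟨hs, hUm _ (by omega) (by omega) hy⟩
        · simp only [Prod.mk.injEq, true_and]; omega
    have h1 := Finset.card_le_card hsub
    have i0 := Finset.card_image_le (s := badSet n P) (f := fun p => (p.1 + 2 * p.2, p.2))
    have i1 := Finset.card_image_le (s := H ×ˢ U) (f := fun p => (p.1, p.1 - p.2))
    have i2 := Finset.card_image_le (s := H ×ˢ U) (f := fun p => (p.1, (p.1 - p.2) / 2))
    have u1 := h1.trans (Finset.card_union_le _ _)
    have u2 := Finset.card_union_le ((badSet n P).image (fun p => (p.1 + 2 * p.2, p.2)))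
      ((H ×ˢ U).image (fun p => (p.1, p.1 - p.2)))
    simp only [Finset.card_product, Nat.card_Icc, Nat.add_sub_cancel] at i1 i2 u1
    omega
  rw [← hLH]
  nlinarith

/-- ordered mismatching pairs of one parity -/
lemma lemA {r : ℕ} (n : ℕ) (P : ℕ → Finset (Fin r)) (A Y : Finset ℕ)
    (hA : A ⊆ Finset.Icc 1 n) (hne : ∀ x ∈ A, (P x).Nonempty) (hYA : Y ⊆ A)
    (hY2 : ∀ x ∈ Y, 2 ≤ (P x).card) (hpar : ∀ x ∈ Y, ∀ y ∈ Y, x % 2 = y % 2) :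
    ((Y ×ˢ Y).filter (fun q => q.1 ≠ q.2 ∧ ¬ (P q.1 = P q.2 ∧ (P q.1).card = 2))).card ≤
      2 * ((badSet n P).card + 3 * ((Finset.Icc 1 n \ A).card * n)) := by
  classical
  have hY1 : ∀ x ∈ Y, 1 ≤ x ∧ x ≤ n := fun x hx => Finset.mem_Icc.1 (hA (hYA hx))
  set D := (Y ×ˢ Finset.Icc 1 n).filter (fun p => p.1 + 2 * p.2 ∈ Y ∧
    ¬ (P p.1 = P (p.1 + 2 * p.2) ∧ (P p.1).card = 2)) with hD
  have hC := lemC n P A D (by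
      intro a d h
      simp only [hD, Finset.mem_filter, Finset.mem_product, Finset.mem_Icc] at h
      have := hY1 _ h.1.1
      have := hY1 _ h.2.1
      omega) (by
      intro a d h h1 h2 h3
      simp only [hD, Finset.mem_filter, Finset.mem_product, Finset.mem_Icc] at h
      exact badT_ends (hY2 _ h.1.1) (hY2 _ h.2.1) (hne _ h2) h.2.2)
  have hsub : ((Y ×ˢ Y).filter (fun q => q.1 ≠ q.2 ∧ ¬ (P q.1 = P q.2 ∧ (P q.1).card = 2))) ⊆
      D.image (fun p => (p.1, p.1 + 2 * p.2)) ∪ D.image (fun p => (p.1 + 2 * p.2, p.1)) := by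
    rintro ⟨x, y⟩ h
    simp only [Finset.mem_filter, Finset.mem_product] at h
    obtain ⟨⟨hx, hy⟩, hxy, hm⟩ := h
    have h1 := hY1 _ hx
    have h2 := hY1 _ hy
    have hp := hpar _ hx _ hy
    rw [Finset.mem_union]
    rcases Nat.lt_or_gt_of_ne hxy with hlt | hlt
    · left
      obtain ⟨d, rfl⟩ : ∃ d, y = x + 2 * d := ⟨(y - x) / 2, by omega⟩
      refine Finset.mem_image.2 ⟨(x, d), ?_, rfl⟩
      simp only [hD, Finset.mem_filter, Finset.mem_product, Finset.mem_Icc]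
      exact ⟨⟨hx, by omega, by omega⟩, hy, hm⟩
    · right
      obtain ⟨d, rfl⟩ : ∃ d, x = y + 2 * d := ⟨(x - y) / 2, by omega⟩
      refine Finset.mem_image.2 ⟨(y, d), ?_, rfl⟩
      simp only [hD, Finset.mem_filter, Finset.mem_product, Finset.mem_Icc]
      refine ⟨⟨hy, by omega, by omega⟩, hx, ?_⟩
      rintro ⟨e1, e2⟩
      exact hm ⟨e1.symm, e1 ▸ e2⟩
  have h1 := (Finset.card_le_card hsub).trans (Finset.card_union_le _ _)
  have i1 := Finset.card_image_le (s := D) (f := fun p => (p.1, p.1 + 2 * p.2))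
  have i2 := Finset.card_image_le (s := D) (f := fun p => (p.1 + 2 * p.2, p.1))
  omega

/-- If the mismatch count is small, then some pair-palette dominates. -/
lemma dominate {r : ℕ} (hr : 3 ≤ r) (P : ℕ → Finset (Fin r)) (Y : Finset ℕ) (K : ℕ)
    (hY2 : ∀ x ∈ Y, 2 ≤ (P x).card)
    (hm : ((Y ×ˢ Y).filter (fun q => q.1 ≠ q.2 ∧ ¬ (P q.1 = P q.2 ∧ (P q.1).card = 2))).card
      < K * K) :
    ∃ p : Finset (Fin r), p.card = 2 ∧ (Y.filter (fun x => P x ≠ p)).card ≤ K := by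
  classical
  by_contra hcon
  push Not at hcon
  have hbig : K < Y.card := by
    obtain ⟨p, hp⟩ : ∃ p : Finset (Fin r), p.card = 2 := by
      obtain ⟨p, -, hp⟩ := Finset.exists_subset_card_eq
        (show 2 ≤ (Finset.univ : Finset (Fin r)).card by simp; omega)
      exact ⟨p, hp⟩
    exact (hcon p hp).trans_le (Finset.card_filter_le _ _)
  have hfib : ∀ x ∈ Y, K ≤ (Y.filter (fun y => x ≠ y ∧ ¬ (P x = P y ∧ (P x).card = 2))).card := by
    intro x hx
    by_cases h2 : (P x).card = 2
    · refine (hcon _ h2).le.trans (Finset.card_le_card ?_)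
      intro y hy
      simp only [Finset.mem_filter] at hy ⊢
      refine ⟨hy.1, ?_, ?_⟩
      · rintro rfl; exact hy.2 rfl
      · rintro ⟨e, -⟩; exact hy.2 e.symm
    · have : (Y.erase x).card = Y.card - 1 := Finset.card_erase_of_mem hx
      refine le_trans (by omega : K ≤ (Y.erase x).card) (Finset.card_le_card ?_)
      intro y hy
      simp only [Finset.mem_filter, Finset.mem_erase] at hy ⊢
      exact ⟨hy.2, fun e => hy.1 e.symm, fun e => h2 e.2⟩
  have hsum : ((Y ×ˢ Y).filter (fun q => q.1 ≠ q.2 ∧ ¬ (P q.1 = P q.2 ∧ (P q.1).card = 2))).card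
      = ∑ x ∈ Y, (Y.filter (fun y => x ≠ y ∧ ¬ (P x = P y ∧ (P x).card = 2))).card := by
    simp only [Finset.card_filter]
    rw [Finset.sum_product]
  have h3 : Y.card * K ≤
      ∑ x ∈ Y, (Y.filter (fun y => x ≠ y ∧ ¬ (P x = P y ∧ (P x).card = 2))).card := by
    have := Finset.card_nsmul_le_sum Y _ K hfib
    simpa using this
  rw [← hsum] at h3
  have : K * K ≤ Y.card * K := Nat.mul_le_mul_right _ hbig.le
  omega

lemma gPA_le_prod {r : ℕ} (A : Finset ℕ) (P : ℕ → Finset (Fin r)) :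
    gPA A P ≤ ∏ x ∈ A, (P x).card := by
  classical
  unfold gPA
  have h1 : Nat.card {c : A → Fin r // RainbowAPFree A c ∧
      ∀ (x : ℕ) (hx : x ∈ A), c ⟨x, hx⟩ ∈ P x} ≤ Nat.card ((x : A) → (P x.1 : Finset (Fin r))) := by
    apply Nat.card_le_card_of_injective
      (fun c => fun x : A => (⟨c.1 x, c.2.2 x.1 x.2⟩ : (P x.1 : Finset (Fin r))))
    intro c c' h
    apply Subtype.ext
    funext x
    have := congrFun h x
    simpa using this
  refine h1.trans (le_of_eq ?_)
  rw [Nat.card_eq_fintype_card, Fintype.card_pi]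
  simp only [Fintype.card_coe]
  exact Finset.prod_coe_sort A (fun x => (P x).card)

lemma gPA_le_pow {r : ℕ} (A : Finset ℕ) (P : ℕ → Finset (Fin r)) (C S : Finset ℕ)
    (hC : ∀ x ∈ A, x ∈ C → (P x).card ≤ 2)
    (hO : ∀ x ∈ A, x ∉ C → x ∉ S → (P x).card ≤ 1) :
    gPA A P ≤ 2 ^ (C.card + r * S.card) := by
  classical
  refine (gPA_le_prod A P).trans ?_
  have hcard : ∀ x, (P x).card ≤ 2 ^ r := by
    intro x
    have := Finset.card_le_univ (P x)
    simp at this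
    exact this.trans Nat.lt_two_pow_self.le
  have h1 : ∏ x ∈ A, (P x).card ≤
      ∏ x ∈ A, 2 ^ ((if x ∈ C then 1 else 0) + r * (if x ∈ S then 1 else 0)) := by
    apply Finset.prod_le_prod'
    intro x hx
    by_cases h1 : x ∈ C
    · refine (hC x hx h1).trans ?_
      rw [if_pos h1, pow_add]
      exact Nat.le_mul_of_pos_right _ (by positivity)
    · by_cases h2 : x ∈ S
      · simpa [h1, h2] using hcard x
      · simpa [h1, h2] using hO x hx h1 h2
  refine h1.trans ?_
  rw [Finset.prod_pow_eq_pow_sum]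
  apply Nat.pow_le_pow_right (by norm_num)
  rw [Finset.sum_add_distrib, ← Finset.mul_sum]
  apply Nat.add_le_add
  · rw [← Finset.card_filter]
    apply Finset.card_le_card
    intro x hx; exact (Finset.mem_filter.1 hx).2
  · apply Nat.mul_le_mul_left
    rw [← Finset.card_filter]
    apply Finset.card_le_card
    intro x hx; exact (Finset.mem_filter.1 hx).2

/-- two different pair-palettes on the two parity classes: many bad 3-APs -/
lemma odd_even {r : ℕ} (n : ℕ) (P : ℕ → Finset (Fin r)) (W : Finset ℕ) (p q : Finset (Fin r))
    (hp : p.card = 2) (hq : q.card = 2) (hpq : p ≠ q)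
    (hW : ∀ x ∈ W, P x = if x % 2 = 0 then p else q) :
    (n / 6) * (n / 6) ≤ (badSet n P).card + 3 * ((Finset.Icc 1 n \ W).card * n) := by
  classical
  have hC := lemC n P W ((Finset.Icc 1 (n / 6) ×ˢ Finset.Icc 1 (n / 6)).image
    (fun t => (t.1, 2 * t.2 - 1))) (by
      intro a d h
      simp only [Finset.mem_image, Finset.mem_product, Finset.mem_Icc, Prod.exists,
        Prod.mk.injEq] at h
      obtain ⟨x, y, h1, h2, h3⟩ := h
      omega) (by
      intro a d h h1 h2 h3
      simp only [Finset.mem_image, Finset.mem_product, Finset.mem_Icc, Prod.exists,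
        Prod.mk.injEq] at h
      obtain ⟨x, y, g1, g2, g3⟩ := h
      have e1 := hW _ h1
      have e2 := hW _ h2
      have e3 := hW _ h3
      apply BadT.swap23
      have hne : (P (a + 2 * d)).Nonempty := by
        rw [← Finset.card_pos, e3]; split_ifs <;> omega
      have c1 : (P a).card = 2 := by rw [e1]; split_ifs <;> assumption
      have c2 : (P (a + d)).card = 2 := by rw [e2]; split_ifs <;> assumption
      apply badT_ends c1.ge c2.ge hne
      rintro ⟨e, -⟩
      rw [e1, e2] at e
      rcases Nat.mod_two_eq_zero_or_one a with h0 | h0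
      · rw [if_pos h0, if_neg (by omega)] at e; exact hpq e
      · rw [if_neg (by omega), if_pos (by omega)] at e; exact hpq e.symm)
  rw [Finset.card_image_of_injOn] at hC
  · simpa using hC
  · rintro ⟨a, d⟩ h ⟨a', d'⟩ h' e
    simp only [Finset.coe_product, Finset.coe_Icc, Set.mem_prod, Set.mem_Icc] at h h'
    simp only [Prod.mk.injEq] at e ⊢
    omega

lemma exp_lt {r : ℕ} {A : Finset ℕ} {P : ℕ → Finset (Fin r)} {y : ℝ} {m : ℕ}
    (h : (2 : ℝ) ^ y < (gPA A P : ℝ)) (h2 : gPA A P ≤ 2 ^ m) : y < m := by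
  have h3 : (gPA A P : ℝ) ≤ (2 : ℝ) ^ (m : ℝ) := by
    rw [Real.rpow_natCast]; exact_mod_cast h2
  exact (Real.rpow_lt_rpow_left_iff (by norm_num)).1 (h.trans_le h3)

set_option maxHeartbeats 2000000 in
lemma core (r : ℕ) (hr : 3 ≤ r) (n : ℕ) (u δ ξ η : ℝ) (hη : η = 1 / (8000 * r))
    (hu0 : 0 ≤ u) (hu1 : u ≤ 1 / 1000) (hδ : δ ≤ 1 / 2000) (hηn : 1 ≤ η * n)
    (hsm : 2 * u + 6 * ξ ≤ η ^ 2) (hud : 12 * r * u ≤ δ)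
    (A : Finset ℕ) (hA : A ⊆ Finset.Icc 1 n) (hAc : (A.card : ℝ) = (1 - ξ) * n)
    (P : ℕ → Finset (Fin r)) (hne : ∀ x ∈ A, (P x).Nonempty)
    (hT : ((badSet n P).card : ℝ) ≤ u * n ^ 2)
    (hg : (2 : ℝ) ^ ((1 - δ) * n) < (gPA A P : ℝ)) :
    ∃ i j : Fin r, i ≠ j ∧
      (1 - 2 * δ) * n ≤ ((A.filter fun x => P x = {i, j}).card : ℝ) := by
  classical
  have hr0 : (3 : ℝ) ≤ r := by exact_mod_cast hr
  have hη0 : 0 < η := by rw [hη]; positivity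
  have hrη : 8000 * (r * η) = 1 := by rw [hη]; field_simp
  have hn : (8000 : ℝ) ≤ n := by
    have h1 : η ≤ 1 / 8000 := by nlinarith
    have h2 : η * n ≤ 1 / 8000 * n := by gcongr
    linarith
  have hcompl : ∀ W : Finset ℕ, W ⊆ Finset.Icc 1 n →
      ((Finset.Icc 1 n \ W).card : ℝ) = n - W.card := by
    intro W hW
    have := Finset.card_sdiff_add_card_eq_card hW
    simp only [Nat.card_Icc, Nat.add_sub_cancel] at this
    have h2 : ((Finset.Icc 1 n \ W).card : ℝ) + W.card = n := by exact_mod_cast this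
    linarith
  set K := ⌊η * n⌋₊ + 1 with hK
  have hK1 : η * n < K := by rw [hK]; push_cast; exact Nat.lt_floor_add_one _
  have hK2 : (K : ℝ) ≤ 2 * (η * n) := by
    have := Nat.floor_le (show 0 ≤ η * n by linarith)
    rw [hK]; push_cast; linarith
  have dom : ∀ b : ℕ, ∃ p : Finset (Fin r), p.card = 2 ∧
      ((A.filter (fun x => 2 ≤ (P x).card ∧ x % 2 = b)).filter (fun x => P x ≠ p)).card ≤ K := by
    intro b
    have hY2 : ∀ x ∈ A.filter (fun x => 2 ≤ (P x).card ∧ x % 2 = b), 2 ≤ (P x).card :=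
      fun x hx => (Finset.mem_filter.1 hx).2.1
    apply dominate hr P _ K hY2
    refine lt_of_le_of_lt (lemA n P A _ hA hne (Finset.filter_subset _ _) hY2 ?_) ?_
    · intro x hx y hy
      rw [(Finset.mem_filter.1 hx).2.2, (Finset.mem_filter.1 hy).2.2]
    · have h1 := hcompl A hA
      have : (2 * ((badSet n P).card + 3 * ((Finset.Icc 1 n \ A).card * n)) : ℝ) < K * K := by
        rw [h1, hAc]
        have h2 : (2 * u + 6 * ξ) * (n : ℝ) ^ 2 ≤ η ^ 2 * (n : ℝ) ^ 2 := by gcongr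
        have h3 : (η * n) * (η * n) < (K : ℝ) * K := by
          apply mul_self_lt_mul_self (by linarith) hK1
        nlinarith
      exact_mod_cast this
  obtain ⟨p, hp, hpK⟩ := dom 0
  obtain ⟨q, hq, hqK⟩ := dom 1
  set C := A.filter (fun x => P x = if x % 2 = 0 then p else q) with hC
  have hCA : C ⊆ Finset.Icc 1 n := (Finset.filter_subset _ _).trans hA
  have hC1 : (n : ℝ) - C.card ≤ n / 1000 := by
    have h1 := gPA_le_pow A P C
      ((A.filter (fun x => 2 ≤ (P x).card ∧ x % 2 = 0)).filter (fun x => P x ≠ p) ∪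
       (A.filter (fun x => 2 ≤ (P x).card ∧ x % 2 = 1)).filter (fun x => P x ≠ q)) (by
        intro x _ hx
        rw [(Finset.mem_filter.1 hx).2]
        split_ifs
        · exact hp.le
        · exact hq.le) (by
        intro x hx h1 h2
        by_contra h3
        simp only [hC, Finset.mem_union, Finset.mem_filter, not_or, not_and, not_not] at h1 h2
        have h4 := h1 hx
        rcases Nat.mod_two_eq_zero_or_one x with h0 | h0
        · rw [if_pos h0] at h4
          exact h4 (h2.1 ⟨hx, by omega, h0⟩)
        · rw [if_neg (by omega)] at h4
          exact h4 (h2.2 ⟨hx, by omega, h0⟩))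
    have h2 := exp_lt hg h1
    have h3 := (Finset.card_union_le
      ((A.filter (fun x => 2 ≤ (P x).card ∧ x % 2 = 0)).filter (fun x => P x ≠ p))
       ((A.filter (fun x => 2 ≤ (P x).card ∧ x % 2 = 1)).filter (fun x => P x ≠ q))).trans
       (Nat.add_le_add hpK hqK)
    generalize ((A.filter (fun x => 2 ≤ (P x).card ∧ x % 2 = 0)).filter (fun x => P x ≠ p) ∪
       (A.filter (fun x => 2 ≤ (P x).card ∧ x % 2 = 1)).filter (fun x => P x ≠ q)).card = s
       at h2 h3
    have h3' : (s : ℝ) ≤ 4 * (η * n) := by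
      have : (s : ℝ) ≤ K + K := by exact_mod_cast h3
      linarith
    have h4 : (r : ℝ) * s ≤ r * (4 * (η * n)) := by gcongr
    have h5 : (r : ℝ) * (4 * (η * n)) = n / 2000 := by
      have : (r : ℝ) * (4 * (η * n)) = (8000 * (r * η)) * n / 2000 := by ring
      rw [this, hrη, one_mul]
    push_cast at h2
    have h6 : δ * n ≤ 1 / 2000 * n := by gcongr
    nlinarith
  have hpq : p = q := by
    by_contra hpq
    have h1 := odd_even n P C p q hp hq hpq (fun x hx => (Finset.mem_filter.1 hx).2)
    have h2 : (((n / 6 : ℕ) : ℝ)) * ((n / 6 : ℕ) : ℝ) ≤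
        (badSet n P).card + 3 * ((Finset.Icc 1 n \ C).card * n) := by exact_mod_cast h1
    rw [hcompl C hCA] at h2
    have h3 : (n : ℝ) / 7 ≤ ((n / 6 : ℕ) : ℝ) := by
      have : n ≤ 6 * (n / 6) + 5 := by omega
      have : (n : ℝ) ≤ 6 * ((n / 6 : ℕ) : ℝ) + 5 := by exact_mod_cast this
      linarith
    have h4 : (n : ℝ) / 7 * (n / 7) ≤ ((n / 6 : ℕ) : ℝ) * ((n / 6 : ℕ) : ℝ) := by gcongr
    have h5 : (n - C.card : ℝ) * n ≤ n / 1000 * n := by gcongr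
    have h6 : u * (n : ℝ) ^ 2 ≤ 1 / 1000 * (n : ℝ) ^ 2 := by gcongr
    nlinarith
  subst hpq
  simp only [ite_self] at hC
  obtain ⟨i, j, hij, hpe⟩ := Finset.card_eq_two.1 hp
  refine ⟨i, j, hij, ?_⟩
  rw [← hpe, ← hC]
  set S := A.filter (fun x => ¬ P x ⊆ p) with hS
  have hB := lemB n P S C (fun s hs => Finset.mem_Icc.1 (hA (Finset.mem_filter.1 hs).1)) (by
    intro s hs y hy z hz
    rw [hC] at hy hz
    rw [(Finset.mem_filter.1 hy).2, (Finset.mem_filter.1 hz).2]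
    obtain ⟨k, hk, hkp⟩ := Finset.not_subset.1 (Finset.mem_filter.1 hs).2
    rw [hpe] at hkp ⊢
    simp only [Finset.mem_insert, Finset.mem_singleton, not_or] at hkp
    exact ⟨k, hk, i, by simp, j, by simp, hkp.1, hij, hkp.2⟩)
  have hB' : (S.card : ℝ) * ((n / 4 : ℕ) : ℝ) ≤ 2 * (badSet n P).card +
      2 * (S.card * (Finset.Icc 1 n \ C).card) := by exact_mod_cast hB
  rw [hcompl C hCA] at hB'
  have h3 : (n : ℝ) / 5 ≤ ((n / 4 : ℕ) : ℝ) := by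
    have : n ≤ 4 * (n / 4) + 3 := by omega
    have : (n : ℝ) ≤ 4 * ((n / 4 : ℕ) : ℝ) + 3 := by exact_mod_cast this
    linarith
  have h4 : (S.card : ℝ) * (n / 5) ≤ (S.card : ℝ) * ((n / 4 : ℕ) : ℝ) := by gcongr
  have h5 : (S.card : ℝ) * (n - C.card) ≤ S.card * (n / 1000) := by gcongr
  have h6 : (S.card : ℝ) ≤ 12 * u * n := by
    have hnp : (0 : ℝ) < n / 6 := by linarith
    have : (S.card : ℝ) * (n / 6) ≤ 12 * u * n * (n / 6) := by
      have : 0 ≤ (S.card : ℝ) * n := by positivity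
      nlinarith
    exact le_of_mul_le_mul_right this hnp
  have h7 := exp_lt hg (gPA_le_pow A P C S (by
    intro x _ hx
    rw [hC] at hx
    rw [(Finset.mem_filter.1 hx).2, hp]) (by
    intro x hx h1 h2
    rw [hC] at h1
    simp only [hS, Finset.mem_filter, not_and, not_not] at h1 h2
    have h8 := Finset.card_lt_card ((Finset.ssubset_iff_subset_ne).2 ⟨h2 hx, h1 hx⟩)
    omega))
  push_cast at h7
  have h8 : (r : ℝ) * S.card ≤ r * (12 * u * n) := by gcongr
  have h9 : 12 * r * u * n ≤ δ * n := by gcongr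
  nlinarith

lemma asym (κ : ℝ) (hκ : 0 < κ) (M : ℝ) : ∃ n₀ : ℕ, ∀ n : ℕ, n₀ ≤ n →
    (n : ℝ) ^ (-(1/3 : ℝ)) < κ ∧ (n : ℝ) ^ (-(1/3 : ℝ)) * Real.logb 2 n < κ ∧
    0 < Real.logb 2 n ∧ 1 / Real.logb 2 n < κ ∧ M ≤ n := by
  rw [← Filter.eventually_atTop]
  have h1 : Filter.Tendsto (fun n : ℕ => (n : ℝ) ^ (-(1/3 : ℝ))) Filter.atTop (nhds 0) :=
    (tendsto_rpow_neg_atTop (by norm_num)).comp tendsto_natCast_atTop_atTop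
  have h3 : Filter.Tendsto (fun n : ℕ => Real.logb 2 (n : ℝ)) Filter.atTop Filter.atTop :=
    (Real.tendsto_logb_atTop (by norm_num)).comp tendsto_natCast_atTop_atTop
  have h4 : Filter.Tendsto (fun n : ℕ => 1 / Real.logb 2 (n : ℝ)) Filter.atTop (nhds 0) := by
    simp only [one_div]
    exact h3.inv_tendsto_atTop
  have h2 : Filter.Tendsto (fun n : ℕ => (n : ℝ) ^ (-(1/3 : ℝ)) * Real.logb 2 n)
      Filter.atTop (nhds 0) := by
    have h := (isLittleO_log_rpow_atTop (show (0 : ℝ) < 1/3 by norm_num)).tendsto_div_nhds_zero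
    have h' := (h.comp tendsto_natCast_atTop_atTop).div_const (Real.log 2)
    rw [zero_div] at h'
    refine h'.congr ?_
    intro n
    simp only [Function.comp, Real.logb]
    rw [Real.rpow_neg (by positivity)]
    ring
  filter_upwards [h1.eventually_lt_const hκ, h2.eventually_lt_const hκ, h3.eventually_gt_atTop 0,
    h4.eventually_lt_const hκ, tendsto_natCast_atTop_atTop.eventually_ge_atTop M] with n a b c d e
  exact ⟨a, b, c, d, e⟩

theorem stmt_12 (r : ℕ) (hr : 3 ≤ r) :
    ∃ n₀ : ℕ, ∀ n : ℕ, n₀ ≤ n → ∀ δ ξ : ℝ, δ = 1 / (34 * Real.logb 2 n) →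
      0 < ξ → ξ < (Real.logb 2 r - 1) * (n : ℝ) ^ (-(1/3 : ℝ)) * Real.logb 2 n + δ →
      ∀ A : Finset ℕ, A ⊆ Finset.Icc 1 n → (A.card : ℝ) = (1 - ξ) * n →
      ∀ P : ℕ → Finset (Fin r), GoodTemplate n A P →
        (2 : ℝ) ^ ((1 - δ) * n) < (gPA A P : ℝ) →
        ∃ i j : Fin r, i ≠ j ∧
          (1 - 2 * δ) * n ≤ ((A.filter fun x => P x = {i, j}).card : ℝ) := by
  have hr0 : (3 : ℝ) ≤ r := by exact_mod_cast hr
  set η : ℝ := 1 / (8000 * r) with hη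
  have hη0 : 0 < η := by rw [hη]; positivity
  have hη1 : η ≤ 1 / 8000 := by
    rw [hη]
    apply one_div_le_one_div_of_le (by norm_num)
    linarith
  obtain ⟨n₀, hn₀⟩ := asym (η ^ 2 / (20 * r)) (by positivity) (1 / η)
  refine ⟨n₀, ?_⟩
  intro n hn δ ξ hδ hξ0 hξ A hA hAc P hP hg
  obtain ⟨hu, huL, hL, hiL, hM⟩ := hn₀ n hn
  set κ := η ^ 2 / (20 * r) with hκ
  have hκr : r * κ = η ^ 2 / 20 := by rw [hκ]; field_simp
  have hη2 : η ^ 2 ≤ 1 / 64000000 := by nlinarith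
  have hκ0 : 0 < κ := by positivity
  have hu0 : 0 ≤ (n : ℝ) ^ (-(1/3 : ℝ)) := by positivity
  set u := (n : ℝ) ^ (-(1/3 : ℝ)) with hudef
  set L := Real.logb 2 n with hLdef
  have hδ' : δ = (1 / L) / 34 := by rw [hδ]; field_simp
  have hδκ : δ ≤ κ := by
    have : 0 < 1 / L := by positivity
    rw [hδ']; linarith
  have hκs : κ ≤ 1 / 64000000 := by nlinarith
  have hlogr : Real.logb 2 r ≤ r := by
    rw [Real.logb_le_iff_le_rpow (by norm_num) (by linarith), Real.rpow_natCast]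
    exact_mod_cast Nat.lt_two_pow_self.le
  have hξκ : ξ ≤ (r + 1) * κ := by
    have h1 : (Real.logb 2 r - 1) * u * L ≤ r * κ := by
      have h2 : (Real.logb 2 r - 1) * (u * L) ≤ r * (u * L) := by
        apply mul_le_mul_of_nonneg_right (by linarith) (by positivity)
      have h3 : r * (u * L) ≤ r * κ := by gcongr
      linarith
    linarith
  refine core r hr n u δ ξ η hη hu0 (by linarith) (by linarith) ?_ ?_ ?_ A hA hAc P hP.1 ?_ hg
  · rw [div_le_iff₀ hη0] at hM
    linarith
  · nlinarith
  · rw [hδ, le_div_iff₀ (by positivity)]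
    have h3 : r * (u * L) ≤ r * κ := by gcongr
    nlinarith
  · have h1 : ((badSet n P).card : ℝ) ≤ Rtemp n P := by exact_mod_cast badSet_card_le n P
    have h2 : (fAP n : ℝ) ≤ (n : ℝ) ^ 2 := by
      have := fAP_le n
      rw [pow_two]; exact_mod_cast this
    refine h1.trans (hP.2.trans ?_)
    gcongr
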